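/- Let π₀ be the λ⊕⊸ proof of the sequent a, a ⊸ a, a ⊸ a, a ⊸ a ⊢ a built from four axioms a ⊢ a by three successive ⊸* rules (so that its unique slice links the conclusion atoms in a chain). For a permutation σ of the context positions {2, 3, 4}, let π₀ · σ denote a proof obtained from π₀ by a sequence of exchange rules whose composite effect on the context is σ. Then for any permutations σ and τ of {2, 3, 4}, the proofs π₀ · σ and π₀ · τ are equivalent if and only if σ = τ. In particular, the proof obtained from π₀ by applying ex 2 3 and then ex 3 4 is not equivalent to the proof obtained by applying ex 3 4 and then ex 2 3. -/

import Mathlib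

/-- Formulas of the intuitionistic multiplicative-additive calculus λ⊕⊸:
atoms, labeled sums `⊕ₓ`, and linear implication `⊸`. -/
inductive Formula : Type
  | atom : ℕ → Formula
  | oplus : ℕ → Formula → Formula → Formula
  | limp : Formula → Formula → Formula
deriving DecidableEq

namespace Formula

/-- Number of atom occurrences of a formula. -/
def size : Formula → ℕ
  | atom _ => 1
  | oplus _ A B => A.size + B.size
  | limp A B => A.size + B.size

/-- The list of Boolean-variable labels of the `⊕` occurrences of a formula. -/
def labels : Formula → List ℕ
  | atom _ => []
  | oplus x A B => x :: (A.labels ++ B.labels)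
  | limp A B => A.labels ++ B.labels

end Formula

/-- Number of atom occurrences of a context. -/
def csz (Γ : List Formula) : ℕ := (Γ.map Formula.size).sum

/-- All labels of `⊕` occurrences of a sequent `Γ ⊢ C`. -/
def seqLabels (Γ : List Formula) (C : Formula) : List ℕ :=
  (Γ.map Formula.labels).flatten ++ C.labels

/-- Cut-free, η-expanded sequent calculus proofs of λ⊕⊸. -/
inductive Proof : List Formula → Formula → Type
  | ax (a : ℕ) : Proof [.atom a] (.atom a)
  | limpR {Γ : List Formula} {A B : Formula} :
      Proof (Γ ++ [A]) B → Proof Γ (.limp A B)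
  | limpL {Γ Δ : List Formula} {A B C : Formula} :
      Proof Γ A → Proof (B :: Δ) C → Proof (Γ ++ .limp A B :: Δ) C
  | ex (Γ₁ Γ₂ Γ₃ : List Formula) (A B : Formula) {C : Formula} :
      Proof (Γ₁ ++ A :: (Γ₂ ++ B :: Γ₃)) C → Proof (Γ₁ ++ B :: (Γ₂ ++ A :: Γ₃)) C
  | oplusR1 (x : ℕ) {Γ : List Formula} {A B : Formula} :
      Proof Γ A → Proof Γ (.oplus x A B)
  | oplusR2 (x : ℕ) {Γ : List Formula} {A B : Formula} :
      Proof Γ B → Proof Γ (.oplus x A B)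
  | oplusL (x : ℕ) {Γ : List Formula} {A B C : Formula} :
      Proof (Γ ++ [A]) C → Proof (Γ ++ [B]) C → Proof (Γ ++ [.oplus x A B]) C

/-- Atom occurrences of a sequent `Γ ⊢ C` are identified with the positions
`0, 1, 2, …` in the left-to-right flattening of `Γ` followed by `C`.
A slice is a finite set of unordered pairs of such positions. -/
abbrev Slice := Finset (Sym2 ℕ)

/-- Reindexing the atom occurrences of a slice along a map of positions. -/
def Slice.reindex (f : ℕ → ℕ) (l : Slice) : Slice := l.image (Sym2.map f)

/-- Position reindex for the exchange rule: maps the positions of the layout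
`[a-block][p-block][b-block][q-block]rest` to those of `[a-block][q-block][b-block][p-block]rest`. -/
def swapMap (a p b q : ℕ) (i : ℕ) : ℕ :=
  if i < a then i
  else if i < a + p then i + q + b
  else if i < a + p + b then i - p + q
  else if i < a + p + b + q then i - p - b
  else i

/-- The slicing 𝒮(π) of a λ⊕⊸ proof. -/
def Proof.slicing : {Γ : List Formula} → {C : Formula} → Proof Γ C → Finset Slice
  | _, _, .ax _ => {({s(0, 1)} : Slice)}
  | _, _, .limpR p => p.slicing
  | _, _, @Proof.limpL Γ _ A _ _ p q =>
      Finset.image₂ (fun l m => l ∪ Slice.reindex (fun i => i + (csz Γ + A.size)) m)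
        p.slicing q.slicing
  | _, _, @Proof.ex Γ₁ Γ₂ _ A B _ p =>
      p.slicing.image (Slice.reindex (swapMap (csz Γ₁) A.size (csz Γ₂) B.size))
  | _, _, .oplusR1 _ p => p.slicing
  | _, _, @Proof.oplusR2 _ Γ A _ p =>
      p.slicing.image (Slice.reindex (fun i => if i < csz Γ then i else i + A.size))
  | _, _, @Proof.oplusL _ Γ A B _ p q =>
      p.slicing.image (Slice.reindex (fun i => if i < csz Γ + A.size then i else i + B.size))
      ∪ q.slicing.image (Slice.reindex (fun i => if i < csz Γ then i else i + A.size))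

/-- Binary decision trees: leaves labeled `0`/`1` (as `Bool`), inner vertices labeled
by Boolean variables; `node x l r` has left subtree `l` and right subtree `r`. -/
inductive BDT : Type
  | leaf : Bool → BDT
  | node : ℕ → BDT → BDT → BDT
deriving DecidableEq

namespace BDT

/-- Evaluation of a BDT under a valuation: go left when the variable is `false` (0),
right when it is `true` (1). -/
def eval (v : ℕ → Bool) : BDT → Bool
  | leaf b => b
  | node x l r => if v x then r.eval v else l.eval v

/-- Two BDTs are equivalent when they compute the same Boolean function. -/
def Equiv (φ ψ : BDT) : Prop := ∀ v : ℕ → Bool, φ.eval v = ψ.eval v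

/-- Variables occurring in a BDT. -/
def vars : BDT → Finset ℕ
  | leaf _ => ∅
  | node x l r => insert x (l.vars ∪ r.vars)

/-- A BDT is free when no variable occurs twice on a path from the root to a leaf. -/
def Free : BDT → Prop
  | leaf _ => True
  | node x l r => x ∉ l.vars ∧ x ∉ r.vars ∧ l.Free ∧ r.Free

/-- Negation of a BDT: swap the 0/1 labels at the leaves. -/
def neg : BDT → BDT
  | leaf b => leaf !b
  | node x l r => node x l.neg r.neg

end BDT

/-- The BDT slicing B(π) of a proof, as a function of two atom positions of the
conclusion sequent (it is symmetric in the two positions, and `0` on positions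
that do not correspond to a pair of atoms of the sequent). -/
def Proof.bdt : {Γ : List Formula} → {C : Formula} → Proof Γ C → ℕ → ℕ → BDT
  | _, _, .ax _, i, j =>
      if (i = 0 ∧ j = 1) ∨ (i = 1 ∧ j = 0) then .leaf true else .leaf false
  | _, _, .limpR p, i, j => p.bdt i j
  | _, _, @Proof.limpL Γ _ A _ _ p q, i, j =>
      if i < csz Γ + A.size ∧ j < csz Γ + A.size then p.bdt i j
      else if csz Γ + A.size ≤ i ∧ csz Γ + A.size ≤ j then
        q.bdt (i - (csz Γ + A.size)) (j - (csz Γ + A.size))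
      else .leaf false
  | _, _, @Proof.ex Γ₁ Γ₂ _ A B _ p, i, j =>
      p.bdt (swapMap (csz Γ₁) B.size (csz Γ₂) A.size i)
            (swapMap (csz Γ₁) B.size (csz Γ₂) A.size j)
  | _, _, @Proof.oplusR1 _ Γ A _ p, i, j =>
      if i < csz Γ + A.size ∧ j < csz Γ + A.size then p.bdt i j else .leaf false
  | _, _, @Proof.oplusR2 _ Γ A _ p, i, j =>
      if (i < csz Γ ∨ csz Γ + A.size ≤ i) ∧ (j < csz Γ ∨ csz Γ + A.size ≤ j) then
        p.bdt (if i < csz Γ then i else i - A.size) (if j < csz Γ then j else j - A.size)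
      else .leaf false
  | _, _, @Proof.oplusL x Γ A B _ p q, i, j =>
      if ((csz Γ ≤ i ∧ i < csz Γ + A.size) ∧ (csz Γ + A.size ≤ j ∧ j < csz Γ + A.size + B.size)) ∨
         ((csz Γ ≤ j ∧ j < csz Γ + A.size) ∧ (csz Γ + A.size ≤ i ∧ i < csz Γ + A.size + B.size)) then
        .leaf false
      else if (csz Γ ≤ i ∧ i < csz Γ + A.size) ∨ (csz Γ ≤ j ∧ j < csz Γ + A.size) then
        .node x (p.bdt (if i < csz Γ + A.size then i else i - B.size)
                       (if j < csz Γ + A.size then j else j - B.size)) (.leaf false)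
      else if (csz Γ + A.size ≤ i ∧ i < csz Γ + A.size + B.size) ∨
              (csz Γ + A.size ≤ j ∧ j < csz Γ + A.size + B.size) then
        .node x (.leaf false) (q.bdt (if i < csz Γ then i else i - A.size)
                                     (if j < csz Γ then j else j - A.size))
      else
        .node x (p.bdt (if i < csz Γ + A.size then i else i - B.size)
                       (if j < csz Γ + A.size then j else j - B.size))
                (q.bdt (if i < csz Γ then i else i - A.size)
                       (if j < csz Γ then j else j - A.size))

/-- Smaller element of an unordered pair of positions. -/
def pmin (p : Sym2 ℕ) : ℕ := Sym2.lift ⟨fun a b => min a b, fun a b => min_comm a b⟩ p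
/-- Larger element of an unordered pair of positions. -/
def pmax (p : Sym2 ℕ) : ℕ := Sym2.lift ⟨fun a b => max a b, fun a b => max_comm a b⟩ p

/-- The BDT slicing B(π) at an unordered pair of atom positions. -/
def Proof.bdtAt {Γ : List Formula} {C : Formula} (π : Proof Γ C) (p : Sym2 ℕ) : BDT :=
  π.bdt (pmin p) (pmax p)

/-- The slice obtained by evaluating the BDT slicing of `π` under a valuation `v`:
the set of pairs whose BDT evaluates to `1`. -/
def Proof.vslice {Γ : List Formula} {C : Formula} (π : Proof Γ C) (v : ℕ → Bool) :
    Set (Sym2 ℕ) :=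
  {p : Sym2 ℕ | (π.bdtAt p).eval v = true}

/-- The labels of the `⊕†` rules of a proof (its Boolean variables). -/
def Proof.labels : {Γ : List Formula} → {C : Formula} → Proof Γ C → List ℕ
  | _, _, .ax _ => []
  | _, _, .limpR p => p.labels
  | _, _, .limpL p q => p.labels ++ q.labels
  | _, _, .ex _ _ _ _ _ p => p.labels
  | _, _, .oplusR1 _ p => p.labels
  | _, _, .oplusR2 _ p => p.labels
  | _, _, .oplusL x p q => x :: (p.labels ++ q.labels)

/-- Number of rule occurrences of a proof. -/
def Proof.size : {Γ : List Formula} → {C : Formula} → Proof Γ C → ℕ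
  | _, _, .ax _ => 1
  | _, _, .limpR p => p.size + 1
  | _, _, .limpL p q => p.size + q.size + 1
  | _, _, .ex _ _ _ _ _ p => p.size + 1
  | _, _, .oplusR1 _ p => p.size + 1
  | _, _, .oplusR2 _ p => p.size + 1
  | _, _, .oplusL x p q => p.size + q.size + 1

/-- The atom `a`. -/
def aF : Formula := .atom 1
/-- The formula `a ⊸ a`. -/
def fF : Formula := .limp aF aF
/-- The context `a, a ⊸ a, a ⊸ a, a ⊸ a`. -/
def ctx4 : List Formula := [aF, fF, fF, fF]

/-- The proof `π₀` of `a, a ⊸ a, a ⊸ a, a ⊸ a ⊢ a` built from four axioms by three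
`⊸*` rules (its unique slice links the atoms in a chain). -/
def pi0 : Proof ctx4 aF :=
  Proof.limpL (Γ := [aF, fF, fF])
    (Proof.limpL (Γ := [aF, fF])
      (Proof.limpL (Γ := [aF]) (Proof.ax 1) (Proof.ax 1))
      (Proof.ax 1))
    (Proof.ax 1)

/-- Application of one exchange rule swapping two of the context positions `2, 3, 4`
(numbered here `0, 1, 2` among the three `a ⊸ a` formulas; position `1`, holding `a`,
is kept fixed). -/
def applyEx (i j : Fin 3) (p : Proof ctx4 aF) : Proof ctx4 aF :=
  match i.val, j.val with
  | 0, 1 => Proof.ex [aF] [] [fF] fF fF p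
  | 1, 0 => Proof.ex [aF] [] [fF] fF fF p
  | 1, 2 => Proof.ex [aF, fF] [] [] fF fF p
  | 2, 1 => Proof.ex [aF, fF] [] [] fF fF p
  | 0, 2 => Proof.ex [aF] [fF] [] fF fF p
  | 2, 0 => Proof.ex [aF] [fF] [] fF fF p
  | _, _ => p

/-- `ExReach ρ σ` holds when `ρ` is obtained from `π₀` by a sequence of exchange rules
(on the positions `2, 3, 4`) whose composite effect on the context is the permutation
`σ`; such a `ρ` is a proof `π₀ ⬝ σ`. -/
inductive ExReach : Proof ctx4 aF → Equiv.Perm (Fin 3) → Prop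
  | refl : ExReach pi0 1
  | step {ρ : Proof ctx4 aF} {σ : Equiv.Perm (Fin 3)} (i j : Fin 3) :
      ExReach ρ σ → ExReach (applyEx i j ρ) (Equiv.swap i j * σ)

/-- The slice chaining the atoms of `ctx4 ⊢ aF` through the three implications, visiting the
`k`-th one (whose atoms are at positions `2 * k + 1` and `2 * k + 2`) in the order
`σ 0, σ 1, σ 2`. -/
def chainSlice (σ : Equiv.Perm (Fin 3)) : Slice :=
  {s(0, 2 * (σ 0).val + 1), s(2 * (σ 0).val + 2, 2 * (σ 1).val + 1),
    s(2 * (σ 1).val + 2, 2 * (σ 2).val + 1), s(2 * (σ 2).val + 2, 7)}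

theorem pi0_slicing : pi0.slicing = {chainSlice 1} := by
  decide

theorem slicing_applyEx {ρ : Proof ctx4 aF} {σ : Equiv.Perm (Fin 3)}
    (h : ρ.slicing = {chainSlice σ}) (i j : Fin 3) :
    (applyEx i j ρ).slicing = {chainSlice (Equiv.swap i j * σ)} := by
  have h01 : ∀ σ, Slice.reindex (swapMap 1 2 0 2) (chainSlice σ) =
      chainSlice (Equiv.swap 0 1 * σ) := by decide
  have h12 : ∀ σ, Slice.reindex (swapMap 3 2 0 2) (chainSlice σ) =
      chainSlice (Equiv.swap 1 2 * σ) := by decide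
  have h02 : ∀ σ, Slice.reindex (swapMap 1 2 2 2) (chainSlice σ) =
      chainSlice (Equiv.swap 0 2 * σ) := by decide
  have e01 : (applyEx 0 1 ρ).slicing = ρ.slicing.image (Slice.reindex (swapMap 1 2 0 2)) := rfl
  have e12 : (applyEx 1 2 ρ).slicing = ρ.slicing.image (Slice.reindex (swapMap 3 2 0 2)) := rfl
  have e02 : (applyEx 0 2 ρ).slicing = ρ.slicing.image (Slice.reindex (swapMap 1 2 2 2)) := rfl
  rw [h, Finset.image_singleton] at e01 e12 e02
  rw [h01] at e01
  rw [h12] at e12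
  rw [h02] at e02
  have hself (k : Fin 3) : chainSlice (Equiv.swap k k * σ) = chainSlice σ := by
    rw [Equiv.swap_self]
    rfl
  fin_cases i <;> fin_cases j
  · exact h.trans (by rw [hself])
  · exact e01
  · exact e02
  · exact e01.trans (by rw [Equiv.swap_comm]; rfl)
  · exact h.trans (by rw [hself])
  · exact e12
  · exact e02.trans (by rw [Equiv.swap_comm]; rfl)
  · exact e12.trans (by rw [Equiv.swap_comm]; rfl)
  · exact h.trans (by rw [hself])

theorem ExReach.slicing_eq {ρ : Proof ctx4 aF} {σ : Equiv.Perm (Fin 3)} (h : ExReach ρ σ) :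
    ρ.slicing = {chainSlice σ} := by
  induction h with
  | refl => exact pi0_slicing
  | step i j _ ih => exact slicing_applyEx ih i j

theorem chainSlice_injective : Function.Injective chainSlice := by
  have h : ∀ σ τ, chainSlice σ = chainSlice τ → σ = τ := by decide
  exact fun σ τ => h σ τ

/-- For any permutations `σ`, `τ` of the context positions `{2,3,4}`, the proofs
`π₀ ⬝ σ` and `π₀ ⬝ τ` are equivalent iff `σ = τ`; in particular applying `ex 2 3` then
`ex 3 4` to `π₀` is not equivalent to applying `ex 3 4` then `ex 2 3`. -/
theorem exchange_order_matters :
    (∀ (σ τ : Equiv.Perm (Fin 3)) (ρ₁ ρ₂ : Proof ctx4 aF),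
        ExReach ρ₁ σ → ExReach ρ₂ τ → (ρ₁.slicing = ρ₂.slicing ↔ σ = τ)) ∧
      (applyEx 1 2 (applyEx 0 1 pi0)).slicing ≠ (applyEx 0 1 (applyEx 1 2 pi0)).slicing := by
  have key (σ τ : Equiv.Perm (Fin 3)) (ρ₁ ρ₂ : Proof ctx4 aF) (h₁ : ExReach ρ₁ σ)
      (h₂ : ExReach ρ₂ τ) : ρ₁.slicing = ρ₂.slicing ↔ σ = τ := by
    rw [h₁.slicing_eq, h₂.slicing_eq, Finset.singleton_inj, chainSlice_injective.eq_iff]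
  refine ⟨key, fun h => ?_⟩
  have hne : Equiv.swap (1 : Fin 3) 2 * (Equiv.swap 0 1 * 1) ≠
      Equiv.swap 0 1 * (Equiv.swap 1 2 * 1) := by decide
  exact hne ((key _ _ _ _ ((ExReach.refl.step 0 1).step 1 2)
    ((ExReach.refl.step 1 2).step 0 1)).1 h)
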